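/- Let r be either a finite rooted ordered tree with at least two vertices (r ∈ 𝔗_f) or r ∈ 𝔗_∞, with leaves l_1 < l_2 < ⋯ (to the left of the infinite spine if r ∈ 𝔗_∞) in increasing lexicographic order, s_i = #{v ∈ r : v < l_i}, p_i = |l_i|. For j ≥ 1 define α_{r,j} = #({s_i − p_i + 1 : 1 ≤ i ≤ j}^c ∩ {1,…,j}) and β_{r,j} = inf{ℓ : #({s_i : 1 ≤ i ≤ ℓ}^c ∩ {1,…,ℓ}) ≥ α_{r,j}}. Then the unique increasing bijection from {s_i − p_i + 1 : i ≥ 1}^c to {s_i : i ≥ 1}^c (complements taken in [n] with n = |r| − 1 if r is finite, in ℕ if r ∈ 𝔗_∞) is the map j ↦ β_{r,j}; in particular, if j ∈ {s_i − p_i + 1 : i ≥ 1}^c then Φ^{321}_r(j) = β_{r,j}. -/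

import Mathlib

open Set Filter MeasureTheory Topology TopologicalSpace
open scoped ENNReal

namespace AvoidPaper

/-- Instances for the codomain `ℕ∞` (one-point compactification of `ℕ`). -/
instance : SecondCountableTopology ℕ∞ := by
  have h : ({s : Set ℕ∞ | ∃ a, s = Set.Ioi a ∨ s = Set.Iio a}).Countable := by
    have hsub : {s : Set ℕ∞ | ∃ a, s = Set.Ioi a ∨ s = Set.Iio a}
        ⊆ Set.range (Set.Ioi : ℕ∞ → Set ℕ∞) ∪ Set.range (Set.Iio : ℕ∞ → Set ℕ∞) := by
      rintro s ⟨a, rfl | rfl⟩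
      · exact Or.inl ⟨a, rfl⟩
      · exact Or.inr ⟨a, rfl⟩
    exact ((Set.countable_range _).union (Set.countable_range _)).mono hsub
  exact SecondCountableTopology.mk' h

instance : OpensMeasurableSpace ℕ∞ := ⟨le_top⟩

/-! ## Ulam–Harris vertices and rooted ordered trees -/

/-- A vertex of the Ulam–Harris tree: a finite list of natural numbers (children indices),
ordered lexicographically (so an ancestor precedes its descendants). -/
abbrev Vertex : Type := List ℕ

/-- A (rooted ordered) tree: contains the root, is closed under ancestors, and is
left-closed among siblings. -/
def IsTree (t : Set Vertex) : Prop :=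
  ([] : Vertex) ∈ t ∧ (∀ u v : Vertex, u ++ v ∈ t → u ∈ t) ∧
    ∀ (u : Vertex) (i j : ℕ), u ++ [i] ∈ t → j ≤ i → u ++ [j] ∈ t

/-- The set of children indices of `u` in `t`. -/
def children (t : Set Vertex) (u : Vertex) : Set ℕ := {i | u ++ [i] ∈ t}

/-- Locally finite tree. -/
def LocFin (t : Set Vertex) : Prop := ∀ u : Vertex, (children t u).Finite

/-- Number of children of `u` in `t`. -/
noncomputable def childCount (t : Set Vertex) (u : Vertex) : ℕ := (children t u).ncard

/-- The degree function `d_t(u)`: number of children, and `-1` if `u ∉ t`. -/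
noncomputable def deg (t : Set Vertex) (u : Vertex) : ℤ :=
  haveI := Classical.dec (u ∈ t)
  if u ∈ t then (childCount t u : ℤ) else -1

/-- `t^[m]`: restriction of `t` to the vertices of height at most `m`. -/
def trunc (t : Set Vertex) (m : ℕ) : Set Vertex := {u ∈ t | u.length ≤ m}

/-- Local convergence of trees: `d_{t_n}(u) → d_t(u)` for every vertex `u`
(equivalently, eventual equality, since degrees are integers). -/
def LocalConv (ts : ℕ → Set Vertex) (t : Set Vertex) : Prop :=
  ∀ u : Vertex, ∀ᶠ n in atTop, deg (ts n) u = deg t u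

/-- A leaf: a vertex of `t` with no children. -/
def IsLeaf (t : Set Vertex) (v : Vertex) : Prop := v ∈ t ∧ ∀ i : ℕ, v ++ [i] ∉ t

def leafSet (t : Set Vertex) : Set Vertex := {v | IsLeaf t v}

/-- The fringe subtree `t_v` of `t` at `v` (as a subset of `t`). -/
def fringe (t : Set Vertex) (v : Vertex) : Set Vertex := {x ∈ t | v <+: x}

/-- Number of vertices of `t` at height exactly `k`. -/
noncomputable def levelCount (t : Set Vertex) (k : ℕ) : ℕ := {u ∈ t | u.length = k}.ncard

/-- An infinite spine of `t`: `η 0` is the root and `η (i+1)` is a child of `η i`. -/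
def IsSpine (t : Set Vertex) (η : ℕ → Vertex) : Prop :=
  η 0 = [] ∧ (∀ i, η i ∈ t) ∧ ∀ i, ∃ c : ℕ, η (i + 1) = η i ++ [c]

/-- `v` lies strictly to the left of the spine `η`. -/
def LeftOfSpine (t : Set Vertex) (η : ℕ → Vertex) (v : Vertex) : Prop :=
  v ∈ t ∧ (∀ i, η i ≠ v) ∧ ∃ j, v < η j

/-- `v` lies strictly to the right of the spine `η`. -/
def RightOfSpine (t : Set Vertex) (η : ℕ → Vertex) (v : Vertex) : Prop :=
  v ∈ t ∧ ∀ j, η j < v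

/-- `η` is the unique infinite spine of `t`, with infinitely many subtrees attached to
the left and to the right of the spine, infinitely many of the left ones having at
least two vertices. -/
def SpineSpec (t : Set Vertex) (η : ℕ → Vertex) : Prop :=
  IsSpine t η ∧ (∀ η', IsSpine t η' → η' = η) ∧
  {u : Vertex | (∃ k c, u = η k ++ [c]) ∧ LeftOfSpine t η u}.Infinite ∧
  {u : Vertex | (∃ k c, u = η k ++ [c]) ∧ RightOfSpine t η u}.Infinite ∧
  {u : Vertex | (∃ k c, u = η k ++ [c]) ∧ LeftOfSpine t η u ∧
      2 ≤ (fringe t u).encard}.Infinite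

/-- `𝔗_f`: finite trees with at least two vertices. -/
def MemTf (t : Set Vertex) : Prop := IsTree t ∧ t.Finite ∧ 2 ≤ t.encard

/-- `𝔗_∞`. -/
def MemTinf (t : Set Vertex) : Prop :=
  IsTree t ∧ LocFin t ∧ t.Infinite ∧ ∃ η : ℕ → Vertex, SpineSpec t η

/-- The leaves of `t` lying to the left of the spine `η`. -/
def leftLeaves (t : Set Vertex) (η : ℕ → Vertex) : Set Vertex :=
  {x | IsLeaf t x ∧ LeftOfSpine t η x}

/-- `v` is the enumeration `(v_{t,i})` of (an initial part of) `t` in increasing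
lexicographic order: `v i ∈ t` and the vertices of `t` smaller than `v i` are
exactly `v 0, …, v (i-1)`. -/
def IsLexEnum (t : Set Vertex) (v : ℕ → Vertex) : Prop :=
  ∀ i : ℕ, (i : ℕ∞) < t.encard →
    v i ∈ t ∧ {x ∈ t | x < v i} = v '' {j | j < i}

/-- `w` is the enumeration `(w_{t,i})` of (a final part of) `t` in decreasing
lexicographic order, starting from the lexicographically largest vertex. -/
def IsLexCoEnum (t : Set Vertex) (w : ℕ → Vertex) : Prop :=
  ∀ i : ℕ, (i : ℕ∞) < t.encard →
    w i ∈ t ∧ {x ∈ t | w i < x} = w '' {j | j < i}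

/-- `l` enumerates the set `A` in increasing lexicographic order. -/
def IsEnumOf (A : Set Vertex) (l : ℕ → Vertex) : Prop :=
  ∀ i : ℕ, (i : ℕ∞) < A.encard →
    l i ∈ A ∧ {x ∈ A | x < l i} = l '' {j | j < i}

/-- `s_i`: the number of vertices of `t` lexicographically smaller than the `i`-th leaf
(0-indexed: `l 0` is the paper's `l_1`). -/
noncomputable def sVal (t : Set Vertex) (l : ℕ → Vertex) (i : ℕ) : ℕ :=
  {x ∈ t | x < l i}.ncard

/-- `p_i`: the height of the `i`-th leaf. -/
def pVal (l : ℕ → Vertex) (i : ℕ) : ℕ := (l i).length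

/-! ## The maps Φ^σ -/

/-- `Φ^{231}` as an element of `F(ℕ, ℕ*)` (value `i` outside the range of indices). -/
noncomputable def phi231 (t : Set Vertex) (v : ℕ → Vertex) : ℕ → ℕ∞ := fun i =>
  if 1 ≤ i ∧ (i : ℕ∞) < t.encard then
    ((i : ℕ∞) + (fringe t (v i)).encard) - ((v i).length : ℕ∞)
  else (i : ℕ∞)

noncomputable def phi213 (t : Set Vertex) (v : ℕ → Vertex) : ℕ → ℕ∞ := fun i =>
  if 1 ≤ i ∧ (i : ℕ∞) < t.encard then
    ((t \ fringe t (v i)).encard + ((v i).length : ℕ∞)) - (i : ℕ∞)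
  else (i : ℕ∞)

noncomputable def phi312 (t : Set Vertex) (w : ℕ → Vertex) : ℕ → ℕ∞ := fun i =>
  if 1 ≤ i ∧ (i : ℕ∞) < t.encard then
    ((i : ℕ∞) + ((w (i - 1)).length : ℕ∞)) - (fringe t (w (i - 1))).encard
  else (i : ℕ∞)

noncomputable def phi132 (t : Set Vertex) (w : ℕ → Vertex) : ℕ → ℕ∞ := fun i =>
  if 1 ≤ i ∧ (i : ℕ∞) < t.encard then
    ((t.encard + (fringe t (w (i - 1))).encard) - (i : ℕ∞)) - ((w (i - 1)).length : ℕ∞)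
  else (i : ℕ∞)

/-- `B = {s_i - p_i + 1 : i}` (with `i` ranging over indices `< L` of leaves). -/
def Bset (S P : ℕ → ℕ) (L : ℕ∞) : Set ℕ :=
  {b | ∃ i : ℕ, (i : ℕ∞) < L ∧ S i - P i + 1 = b}

/-- `A = {s_i : i}`. -/
def Aset (S : ℕ → ℕ) (L : ℕ∞) : Set ℕ := {a | ∃ i : ℕ, (i : ℕ∞) < L ∧ S i = a}

/-- The number of elements of `C` in `{1, …, j}`. -/
noncomputable def rankIn (C : Set ℕ) (j : ℕ) : ℕ := (C ∩ Set.Icc 1 j).ncard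

/-- The `a`-th smallest positive element of `C`. -/
noncomputable def nthOf (C : Set ℕ) (a : ℕ) : ℕ :=
  sInf {m : ℕ | a ≤ (C ∩ Set.Icc 1 m).ncard}

open Classical in
/-- `Φ^{321}` built from the data `s, p` (and the number `L` of leaves):
`s_i - p_i + 1 ↦ s_i`, extended by the unique increasing bijection between the
complements (and by the identity outside `[1, n]` in the finite case). -/
noncomputable def phi321Fun (S P : ℕ → ℕ) (L : ℕ∞) : ℕ → ℕ∞ := fun j =>
  if h : j ∈ Bset S P L then (S h.choose : ℕ∞)
  else (nthOf (Aset S L)ᶜ (rankIn (Bset S P L)ᶜ j) : ℕ∞)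

/-- `Φ^{123} = |t| + 1 - Φ^{321}` as an element of `F(ℕ, ℕ*)`. -/
noncomputable def phi123Fun (tc : ℕ∞) (f : ℕ → ℕ∞) : ℕ → ℕ∞ := fun j =>
  if 1 ≤ j ∧ (j : ℕ∞) < tc then (tc + 1) - f j else (j : ℕ∞)

/-! ## Patterns and pattern avoidance -/

def p123 : Equiv.Perm (Fin 3) := Equiv.refl _
noncomputable def p321 : Equiv.Perm (Fin 3) := Equiv.ofBijective ![2, 1, 0] (by decide)
noncomputable def p231 : Equiv.Perm (Fin 3) := Equiv.ofBijective ![1, 2, 0] (by decide)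
noncomputable def p213 : Equiv.Perm (Fin 3) := Equiv.ofBijective ![1, 0, 2] (by decide)
noncomputable def p312 : Equiv.Perm (Fin 3) := Equiv.ofBijective ![2, 0, 1] (by decide)
noncomputable def p132 : Equiv.Perm (Fin 3) := Equiv.ofBijective ![0, 2, 1] (by decide)

/-- `π` contains the length-3 pattern `σ`. -/
def ContainsPat {n : ℕ} (π : Equiv.Perm (Fin n)) (σ : Equiv.Perm (Fin 3)) : Prop :=
  ∃ f : Fin 3 → Fin n, StrictMono f ∧ ∀ j k : Fin 3, σ j < σ k ↔ π (f j) < π (f k)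

/-- `π` avoids the length-3 pattern `σ`. -/
def AvoidsPat {n : ℕ} (π : Equiv.Perm (Fin n)) (σ : Equiv.Perm (Fin 3)) : Prop :=
  ¬ ContainsPat π σ

/-- Trees with `n+1` vertices. -/
def TreeN (n : ℕ) : Type := {t : Set Vertex // IsTree t ∧ t.encard = (n : ℕ∞) + 1}

/-- Embedding of a permutation of `[n]` into `F(ℕ, ℕ*)` by `π(k) = k` for `k > n`
(permutations are `1`-indexed: position `k ∈ [1, n]` corresponds to `k - 1 : Fin n`). -/
noncomputable def embedPerm {n : ℕ} (π : Equiv.Perm (Fin n)) : ℕ → ℕ∞ := fun k =>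
  if h : 1 ≤ k ∧ k ≤ n then (((π ⟨k - 1, by omega⟩ : Fin n) : ℕ) + 1 : ℕ) else (k : ℕ∞)

/-- The (finite) set of permutations of `[n]` avoiding `σ`. -/
noncomputable def avoidFinset (σ : Equiv.Perm (Fin 3)) (n : ℕ) : Finset (Equiv.Perm (Fin n)) :=
  Set.Finite.toFinset (Set.toFinite {π : Equiv.Perm (Fin n) | AvoidsPat π σ})

/-- The law of a uniformly random `σ`-avoiding permutation of `[n]`,
as a measure on `F(ℕ, ℕ*)`. -/
noncomputable def uniformAvoidLaw (σ : Equiv.Perm (Fin 3)) (n : ℕ) : Measure (ℕ → ℕ∞) :=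
  ((avoidFinset σ n).card : ℝ≥0∞)⁻¹ • ∑ π ∈ avoidFinset σ n, Measure.dirac (embedPerm π)


open Classical in
/-- `Φ^σ` for an arbitrary pattern `σ ∈ S_3`, given a tree together with its increasing
vertex enumeration `v`, its decreasing vertex enumeration `w`, and the increasing
enumeration `l` of the relevant set `Lset` of leaves. -/
noncomputable def PhiOf (σ : Equiv.Perm (Fin 3)) (t : Set Vertex)
    (v w l : ℕ → Vertex) (Lset : Set Vertex) : ℕ → ℕ∞ :=
  if σ = p231 then phi231 t v
  else if σ = p213 then phi213 t v
  else if σ = p312 then phi312 t w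
  else if σ = p132 then phi132 t w
  else if σ = p321 then phi321Fun (sVal t l) (pVal l) Lset.encard
  else phi123Fun t.encard (phi321Fun (sVal t l) (pVal l) Lset.encard)

open Classical in
noncomputable def canonSpine (t : Set Vertex) : ℕ → Vertex :=
  if h : ∃ η : ℕ → Vertex, IsSpine t η then h.choose else fun _ => []

open Classical in
noncomputable def canonV (t : Set Vertex) : ℕ → Vertex :=
  if h : ∃ v : ℕ → Vertex, IsLexEnum t v then h.choose else fun _ => []

open Classical in
noncomputable def canonW (t : Set Vertex) : ℕ → Vertex :=
  if h : ∃ w : ℕ → Vertex, IsLexCoEnum t w then h.choose else fun _ => []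

open Classical in
noncomputable def canonL (t : Set Vertex) : ℕ → Vertex :=
  if h : ∃ l : ℕ → Vertex, IsEnumOf (leftLeaves t (canonSpine t)) l then h.choose
  else fun _ => []

/-- `Φ^σ_t` for an infinite tree `t ∈ 𝔗_∞`, using the canonical (unique) spine and
enumerations. -/
noncomputable def PhiCanon (σ : Equiv.Perm (Fin 3)) (t : Set Vertex) : ℕ → ℕ∞ :=
  PhiOf σ t (canonV t) (canonW t) (canonL t) (leftLeaves t (canonSpine t))

/-- σ-algebra on the space of trees: all sets are measurable. -/
instance : MeasurableSpace (Set Vertex) := ⊤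

/-- `μ` is the law of a Galton–Watson tree with offspring distribution `ξ`:
a probability measure, supported on trees, giving each finite tree `t` the
probability `∏_{u ∈ t} ξ(d_t(u))`. -/
def IsGW (ξ : ℕ → ℝ≥0∞) (μ : Measure (Set Vertex)) : Prop :=
  IsProbabilityMeasure μ ∧ μ {t | IsTree t} = 1 ∧
    ∀ t : Set Vertex, IsTree t → ∀ ht : t.Finite,
      μ {t} = ∏ u ∈ ht.toFinset, ξ (childCount t u)

/-- `π` is the permutation `Φ^{321}_t` of `[n]` associated to a finite tree `t` with
`n+1` vertices: for every leaf `v` with `s = #{x ∈ t : x < v}` and `p = |v|`, position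
`s - p + 1` is mapped to `s` (in 0-indexed form: position `s - p` to value `s - 1`),
and `π` is increasing on the remaining positions. -/
def Is321Image (n : ℕ) (t : Set Vertex) (π : Equiv.Perm (Fin n)) : Prop :=
  (∀ v : Vertex, IsLeaf t v →
    ∃ hb : {x ∈ t | x < v}.ncard - v.length < n,
      ((π ⟨{x ∈ t | x < v}.ncard - v.length, hb⟩ : Fin n) : ℕ)
        = {x ∈ t | x < v}.ncard - 1) ∧
  ∀ a b : Fin n, a < b →
    (∀ v : Vertex, IsLeaf t v → {x ∈ t | x < v}.ncard - v.length ≠ (a : ℕ)) →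
    (∀ v : Vertex, IsLeaf t v → {x ∈ t | x < v}.ncard - v.length ≠ (b : ℕ)) →
    π a < π b

/-- `π` is the permutation `Φ^{123}_t = (n+1) - Φ^{321}_t` of `[n]`. -/
def Is123Image (n : ℕ) (t : Set Vertex) (π : Equiv.Perm (Fin n)) : Prop :=
  ∃ π' : Equiv.Perm (Fin n), Is321Image n t π' ∧ ∀ i : Fin n, π i = Fin.rev (π' i)


/-- `α_{r,j} = #({s_i - p_i + 1 : 1 ≤ i ≤ j}ᶜ ∩ {1, …, j})` (indices `i` are 0-based). -/
noncomputable def alphaL (S P : ℕ → ℕ) (L : ℕ∞) (j : ℕ) : ℕ :=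
  ({b : ℕ | ∃ i : ℕ, (i : ℕ∞) < L ∧ i < j ∧ S i - P i + 1 = b}ᶜ ∩ Set.Icc 1 j).ncard

/-- `β_{r,a} = inf{m : #({s_i : 1 ≤ i ≤ m}ᶜ ∩ {1, …, m}) ≥ a}`. -/
noncomputable def betaL (S : ℕ → ℕ) (L : ℕ∞) (a : ℕ) : ℕ :=
  sInf {m : ℕ |
    a ≤ ({b : ℕ | ∃ i : ℕ, (i : ℕ∞) < L ∧ i < m ∧ S i = b}ᶜ ∩ Set.Icc 1 m).ncard}

/-! ## Lexicographic order and prefixes -/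

lemma lt_of_lt_of_not_prefix_of_prefix {v w x : Vertex} (hvw : v < w) (hn : ¬ v <+: w)
    (hx : v <+: x) : x < w := by
  induction v generalizing w x with
  | nil => exact absurd List.nil_prefix hn
  | cons a v ih =>
    obtain ⟨y, rfl⟩ := hx
    cases w with
    | nil => simp at hvw
    | cons b w =>
      rw [List.cons_lt_cons_iff] at hvw
      rw [List.cons_append, List.cons_lt_cons_iff]
      rcases hvw with h | ⟨rfl, h⟩
      · exact Or.inl h
      · refine Or.inr ⟨rfl, ih h ?_ (List.prefix_append v y)⟩
        simpa [List.cons_prefix_cons] using hn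

lemma le_of_prefix {v w : Vertex} (h : v <+: w) : v ≤ w := by
  obtain ⟨y, rfl⟩ := h
  induction v with
  | nil => exact not_lt.1 (by simp)
  | cons a v ih =>
    refine not_lt.1 fun hlt => ?_
    rw [List.cons_append, List.cons_lt_cons_iff] at hlt
    rcases hlt with h | ⟨-, h⟩
    · exact lt_irrefl a h
    · exact not_lt.2 ih h

lemma prefix_of_le_of_lt {a b c : Vertex} (hab : a ≤ b) (hbc : b < c) (hac : a <+: c) :
    a <+: b := by
  rcases hab.eq_or_lt with rfl | hab
  · exact List.prefix_refl a
  · by_contra hn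
    exact lt_asymm hbc (lt_of_lt_of_not_prefix_of_prefix hab hn hac)

lemma lt_append_singleton {x u : Vertex} {c : ℕ} (h : x < u ++ [c]) :
    x < u ∨ x = u ∨ ∃ d < c, u ++ [d] <+: x := by
  rcases lt_trichotomy x u with h1 | h1 | h1
  · exact Or.inl h1
  · exact Or.inr (Or.inl h1)
  · refine Or.inr (Or.inr ?_)
    obtain ⟨y, rfl⟩ := prefix_of_le_of_lt h1.le h (List.prefix_append u [c])
    have hy : y < [c] := by
      clear h1
      induction u with
      | nil => simpa using h
      | cons a u ih =>
        apply ih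
        simpa [List.cons_lt_cons_iff] using h
    cases y with
    | nil => simp at h1
    | cons d y =>
      rw [List.cons_lt_cons_iff] at hy
      rcases hy with hd | ⟨-, hd⟩
      · exact ⟨d, hd, y, by simp⟩
      · simp at hd

/-! ## Ranks of vertices in preorder and in postorder -/

/-- The vertices of `t` preceding `v` in lexicographic order (preorder). -/
def preSet (t : Set Vertex) (v : Vertex) : Set Vertex := {x ∈ t | x < v}

/-- The vertices of `t` that weakly precede `v` in postorder: the descendants of `v`
(including `v`) and the vertices to the left of the path to `v`. -/
def postSet (t : Set Vertex) (v : Vertex) : Set Vertex :=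
  {x ∈ t | v <+: x ∨ x < v ∧ ¬ x <+: v}

lemma ncard_preSet_lt {t : Set Vertex} {v w : Vertex} (hv : v ∈ t) (hvw : v < w)
    (hw : (preSet t w).Finite) : (preSet t v).ncard < (preSet t w).ncard := by
  refine Set.ncard_lt_ncard ⟨fun x hx => ⟨hx.1, hx.2.trans hvw⟩, fun h => ?_⟩ hw
  exact lt_irrefl v (h ⟨hv, hvw⟩).2

lemma ncard_preSet_injOn (t : Set Vertex) :
    Set.InjOn (fun v => (preSet t v).ncard) {v ∈ t | (preSet t v).Finite} := by
  intro v hv w hw h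
  rcases lt_trichotomy v w with hlt | heq | hlt
  · exact absurd h (ncard_preSet_lt hv.1 hlt hw.2).ne
  · exact heq
  · exact absurd h (ncard_preSet_lt hw.1 hlt hv.2).ne'

lemma ncard_postSet_lt {t : Set Vertex} {v w : Vertex} (hwt : w ∈ t) (hvw : v < w)
    (hn : ¬ v <+: w) (hw : (postSet t w).Finite) :
    (postSet t v).ncard < (postSet t w).ncard := by
  refine Set.ncard_lt_ncard ⟨?_, fun h => ?_⟩ hw
  · rintro x ⟨hx, h | ⟨h, hp⟩⟩
    · exact ⟨hx, Or.inr ⟨lt_of_lt_of_not_prefix_of_prefix hvw hn h, fun h' => hn (h.trans h')⟩⟩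
    · exact ⟨hx, Or.inr ⟨h.trans hvw, fun h' => hp (prefix_of_le_of_lt h.le hvw h')⟩⟩
  · rcases (h ⟨hwt, Or.inl (List.prefix_refl w)⟩).2 with h | ⟨h, -⟩
    · exact hn h
    · exact lt_asymm h hvw

lemma ncard_postSet_lt_of_prefix {t : Set Vertex} {v w : Vertex} (hvt : v ∈ t) (hvw : v < w)
    (hp : v <+: w) (hv : (postSet t v).Finite) :
    (postSet t w).ncard < (postSet t v).ncard := by
  refine Set.ncard_lt_ncard ⟨?_, fun h => ?_⟩ hv
  · rintro x ⟨hx, h | ⟨h, hn⟩⟩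
    · exact ⟨hx, Or.inl (hp.trans h)⟩
    · rcases le_or_gt v x with hvx | hxv
      · exact ⟨hx, Or.inl (prefix_of_le_of_lt hvx h hp)⟩
      · exact ⟨hx, Or.inr ⟨hxv, fun h' => hn (h'.trans hp)⟩⟩
  · rcases (h ⟨hvt, Or.inl (List.prefix_refl v)⟩).2 with h | ⟨-, h⟩
    · exact absurd (le_of_prefix h) (not_le.2 hvw)
    · exact h hp

lemma ncard_postSet_injOn (t : Set Vertex) :
    Set.InjOn (fun v => (postSet t v).ncard) {v ∈ t | (postSet t v).Finite} := by
  have key : ∀ v ∈ {v ∈ t | (postSet t v).Finite}, ∀ w ∈ {v ∈ t | (postSet t v).Finite},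
      v < w → (postSet t v).ncard ≠ (postSet t w).ncard := by
    intro v hv w hw hlt
    by_cases hp : v <+: w
    · exact (ncard_postSet_lt_of_prefix hv.1 hlt hp hv.2).ne'
    · exact (ncard_postSet_lt hw.1 hlt hp hw.2).ne
  intro v hv w hw h
  rcases lt_trichotomy v w with hlt | heq | hlt
  · exact absurd h (key v hv w hw hlt)
  · exact heq
  · exact absurd h.symm (key w hw v hv hlt)

lemma IsLeaf.eq_of_prefix {t : Set Vertex} (ht : IsTree t) {v x : Vertex} (hv : IsLeaf t v)
    (hx : x ∈ t) (h : v <+: x) : x = v := by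
  obtain ⟨y, rfl⟩ := h
  cases y with
  | nil => simp
  | cons c y =>
    refine absurd (ht.2.1 (v ++ [c]) y ?_) (hv.2 c)
    simpa using hx

lemma ncard_properPrefixes {t : Set Vertex} (ht : IsTree t) {v : Vertex} (hv : v ∈ t) :
    {x ∈ t | x < v ∧ x <+: v}.ncard = v.length := by
  have : {x ∈ t | x < v ∧ x <+: v} = (fun k => v.take k) '' (Finset.range v.length : Set ℕ) := by
    ext x
    simp only [Set.mem_ofPred_eq, Set.mem_image, Finset.coe_range, Set.mem_Iio]
    constructor
    · rintro ⟨-, hlt, hp⟩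
      refine ⟨x.length, lt_of_le_of_ne hp.length_le fun h => ?_, (List.prefix_iff_eq_take.1 hp).symm⟩
      exact hlt.ne (hp.eq_of_length h)
    · rintro ⟨k, hk, rfl⟩
      refine ⟨ht.2.1 _ (v.drop k) (by simpa using hv), ?_, List.take_prefix k v⟩
      refine lt_of_le_of_ne (le_of_prefix (List.take_prefix k v)) fun h => ?_
      have := congrArg List.length h
      simp at this
      omega
  have hinj : Set.InjOn (fun k => v.take k) (Finset.range v.length : Set ℕ) := by
    intro a ha b hb h
    have := congrArg List.length h
    simp at this ha hb
    omega
  rw [this, hinj.ncard_image, Set.ncard_coe_finset, Finset.card_range]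

lemma ncard_postSet_leaf {t : Set Vertex} (ht : IsTree t) {v : Vertex} (hv : IsLeaf t v)
    (hfin : (preSet t v).Finite) :
    (postSet t v).ncard = (preSet t v).ncard - v.length + 1 := by
  have hpost : postSet t v = insert v {x ∈ t | x < v ∧ ¬ x <+: v} := by
    ext x
    simp only [postSet, Set.mem_ofPred_eq, Set.mem_insert_iff]
    constructor
    · rintro ⟨hx, h | h⟩
      · exact Or.inl (hv.eq_of_prefix ht hx h)
      · exact Or.inr ⟨hx, h⟩
    · rintro (rfl | ⟨hx, h⟩)
      · exact ⟨hv.1, Or.inl (List.prefix_refl _)⟩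
      · exact ⟨hx, Or.inr h⟩
  have hpre : preSet t v = {x ∈ t | x < v ∧ x <+: v} ∪ {x ∈ t | x < v ∧ ¬ x <+: v} := by
    ext x
    simp only [preSet, Set.mem_ofPred_eq, Set.mem_union]
    tauto
  have hf1 : {x ∈ t | x < v ∧ x <+: v}.Finite := hfin.subset fun x hx => ⟨hx.1, hx.2.1⟩
  have hf2 : {x ∈ t | x < v ∧ ¬ x <+: v}.Finite := hfin.subset fun x hx => ⟨hx.1, hx.2.1⟩
  rw [hpost, Set.ncard_insert_of_notMem (fun h => lt_irrefl v h.2.1) hf2, hpre,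
    Set.ncard_union_eq (Set.disjoint_left.2 fun x hx hx' => hx'.2.2 hx.2.2) hf1 hf2,
    ncard_properPrefixes ht hv.1]
  omega

/-! ## Ranks in subsets of `ℕ` -/

lemma rankIn_succ_of_mem {C : Set ℕ} {j : ℕ} (h : j + 1 ∈ C) :
    rankIn C (j + 1) = rankIn C j + 1 := by
  have : C ∩ Set.Icc 1 (j + 1) = insert (j + 1) (C ∩ Set.Icc 1 j) := by
    ext x
    simp only [Set.mem_inter_iff, Set.mem_Icc, Set.mem_insert_iff]
    constructor
    · rintro ⟨hx, h1, h2⟩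
      by_cases hxj : x = j + 1
      · exact Or.inl hxj
      · exact Or.inr ⟨hx, h1, by omega⟩
    · rintro (rfl | ⟨hx, h1, h2⟩)
      · exact ⟨h, by omega, le_rfl⟩
      · exact ⟨hx, h1, by omega⟩
  rw [rankIn, this, Set.ncard_insert_of_notMem (by simp) ((Set.finite_Icc 1 j).inter_of_right C),
    rankIn]

lemma rankIn_succ_of_notMem {C : Set ℕ} {j : ℕ} (h : j + 1 ∉ C) :
    rankIn C (j + 1) = rankIn C j := by
  have : C ∩ Set.Icc 1 (j + 1) = C ∩ Set.Icc 1 j := by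
    ext x
    simp only [Set.mem_inter_iff, Set.mem_Icc]
    constructor
    · rintro ⟨hx, h1, h2⟩
      have : x ≠ j + 1 := by rintro rfl; exact h hx
      exact ⟨hx, h1, by omega⟩
    · rintro ⟨hx, h1, h2⟩
      exact ⟨hx, h1, by omega⟩
  rw [rankIn, this, rankIn]

lemma rankIn_zero (C : Set ℕ) : rankIn C 0 = 0 := by simp [rankIn]

lemma rankIn_mono (C : Set ℕ) : Monotone (rankIn C) := by
  refine monotone_nat_of_le_succ fun j => ?_
  by_cases h : j + 1 ∈ C
  · rw [rankIn_succ_of_mem h]; omega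
  · rw [rankIn_succ_of_notMem h]

lemma rankIn_lt_rankIn {C : Set ℕ} {j k : ℕ} (hjk : j < k) (hk : k ∈ C) :
    rankIn C j < rankIn C k := by
  obtain ⟨k, rfl⟩ : ∃ k', k = k' + 1 := ⟨k - 1, by omega⟩
  rw [rankIn_succ_of_mem hk]
  exact Nat.lt_succ_of_le (rankIn_mono C (by omega))

lemma nthOf_spec {C : Set ℕ} {a m : ℕ} (ha : 1 ≤ a) (hm : a ≤ rankIn C m) :
    1 ≤ nthOf C a ∧ nthOf C a ≤ m ∧ nthOf C a ∈ C ∧ rankIn C (nthOf C a) = a := by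
  have hmem : a ≤ rankIn C (nthOf C a) :=
    Nat.sInf_mem (s := {m : ℕ | a ≤ rankIn C m}) ⟨m, hm⟩
  have hmin : ∀ k < nthOf C a, rankIn C k < a := fun k hk =>
    not_le.1 (Nat.notMem_of_lt_sInf (s := {m : ℕ | a ≤ rankIn C m}) hk)
  have hle : nthOf C a ≤ m := Nat.sInf_le (s := {m : ℕ | a ≤ rankIn C m}) hm
  generalize nthOf C a = q at *
  cases q with
  | zero => rw [rankIn_zero] at hmem; omega
  | succ q =>
    have h := hmin q (Nat.lt_succ_self q)
    by_cases hq : q + 1 ∈ C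
    · rw [rankIn_succ_of_mem hq] at hmem ⊢
      exact ⟨by omega, hle, hq, by omega⟩
    · rw [rankIn_succ_of_notMem hq] at hmem
      omega

/-- On an initial segment `U` of the positive integers in which `C` and `C'` have the same
number of elements, `j ↦ nthOf C (rankIn C' j)` is the increasing bijection from `C'` to `C`. -/
lemma strictMonoOn_bijOn_nthOf {U C C' : Set ℕ} (hU1 : ∀ j ∈ U, 1 ≤ j)
    (hU : ∀ j ∈ U, ∀ k, 1 ≤ k → k ≤ j → k ∈ U)
    (h1 : ∀ j ∈ U, ∃ m ∈ U, rankIn C' j ≤ rankIn C m)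
    (h2 : ∀ m ∈ U, ∃ j ∈ U, rankIn C m ≤ rankIn C' j) :
    StrictMonoOn (fun j => nthOf C (rankIn C' j)) (U ∩ C') ∧
      Set.BijOn (fun j => nthOf C (rankIn C' j)) (U ∩ C') (U ∩ C) := by
  have spec : ∀ {C C' : Set ℕ}, (∀ j ∈ U, ∃ m ∈ U, rankIn C' j ≤ rankIn C m) →
      ∀ j ∈ U ∩ C', nthOf C (rankIn C' j) ∈ U ∩ C ∧
        rankIn C (nthOf C (rankIn C' j)) = rankIn C' j := by
    intro C C' h j hj
    obtain ⟨m, hm, hjm⟩ := h j hj.1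
    have hpos : 1 ≤ rankIn C' j := by
      have := rankIn_lt_rankIn (hU1 j hj.1) hj.2
      omega
    obtain ⟨a, b, c, d⟩ := nthOf_spec hpos hjm
    exact ⟨⟨hU m hm _ a b, c⟩, d⟩
  have hmono : StrictMonoOn (fun j => nthOf C (rankIn C' j)) (U ∩ C') := by
    intro j hj k hk hjk
    by_contra! hle
    have := rankIn_mono C hle
    simp only [(spec h1 j hj).2, (spec h1 k hk).2] at this
    exact absurd (rankIn_lt_rankIn hjk hk.2) (not_lt.2 this)
  refine ⟨hmono, fun j hj => (spec h1 j hj).1, hmono.injOn, fun m hm => ?_⟩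
  obtain ⟨hj, hr⟩ := spec h2 m hm
  refine ⟨_, hj, ?_⟩
  obtain ⟨hm', hr'⟩ := spec h1 _ hj
  rw [hr] at hm' hr'
  dsimp only
  rw [hr]
  rcases lt_trichotomy (nthOf C (rankIn C m)) m with h | h | h
  · exact absurd hr' (rankIn_lt_rankIn h hm.2).ne
  · exact h
  · exact absurd hr' (rankIn_lt_rankIn h hm'.2).ne'

lemma exists_le_rankIn {C : Set ℕ} (hC : C.Infinite) (a : ℕ) : ∃ m, 1 ≤ m ∧ a ≤ rankIn C m := by
  induction a with
  | zero => exact ⟨1, le_rfl, Nat.zero_le _⟩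
  | succ a ih =>
    obtain ⟨m, -, hm⟩ := ih
    obtain ⟨k, hk, hmk⟩ := hC.exists_gt m
    have := rankIn_lt_rankIn hmk hk
    exact ⟨k, by omega, by omega⟩

lemma rankIn_compl {A : Set ℕ} {n : ℕ} (hA : A ⊆ Set.Icc 1 n) : rankIn Aᶜ n = n - A.ncard := by
  rw [rankIn, Set.inter_comm, ← Set.sdiff_eq, Set.ncard_sdiff hA ((Set.finite_Icc 1 n).subset hA)]
  simp [← Finset.coe_Icc, Set.ncard_coe_finset]

/-! ## Removing the index restrictions in `alphaL` and `betaL` -/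

lemma succ_le_of_strictMono_of_pos {T : ℕ → ℕ} {L : ℕ∞} (hT1 : ∀ i : ℕ, (i : ℕ∞) < L → 1 ≤ T i)
    (hT : ∀ i k : ℕ, i < k → (k : ℕ∞) < L → T i < T k) (i : ℕ) (hi : (i : ℕ∞) < L) :
    i + 1 ≤ T i := by
  induction i with
  | zero => exact hT1 0 hi
  | succ i ih =>
    have h1 := ih (lt_of_le_of_lt (by exact_mod_cast Nat.le_succ i) hi)
    have h2 := hT i (i + 1) (Nat.lt_succ_self i) hi
    omega

lemma compl_inter_Icc_eq {T : ℕ → ℕ} {L : ℕ∞} (hT : ∀ i : ℕ, (i : ℕ∞) < L → i + 1 ≤ T i)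
    (j : ℕ) :
    {b : ℕ | ∃ i : ℕ, (i : ℕ∞) < L ∧ i < j ∧ T i = b}ᶜ ∩ Set.Icc 1 j =
      (Aset T L)ᶜ ∩ Set.Icc 1 j := by
  ext b
  simp only [Set.mem_inter_iff, Set.mem_compl_iff, Set.mem_ofPred_eq, Aset, Set.mem_Icc]
  refine and_congr_left fun hb => not_congr ⟨fun ⟨i, h1, _, h3⟩ => ⟨i, h1, h3⟩, ?_⟩
  rintro ⟨i, h1, h3⟩
  have := hT i h1
  exact ⟨i, h1, by omega, h3⟩

lemma alphaL_eq_rankIn {S P : ℕ → ℕ} {L : ℕ∞}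
    (hT : ∀ i : ℕ, (i : ℕ∞) < L → i + 1 ≤ S i - P i + 1) (j : ℕ) :
    alphaL S P L j = rankIn (Bset S P L)ᶜ j :=
  congrArg Set.ncard (compl_inter_Icc_eq (T := fun i => S i - P i + 1) hT j)

lemma betaL_eq_nthOf {S : ℕ → ℕ} {L : ℕ∞} (hS : ∀ i : ℕ, (i : ℕ∞) < L → i + 1 ≤ S i) (a : ℕ) :
    betaL S L a = nthOf (Aset S L)ᶜ a := by
  simp only [betaL, nthOf, compl_inter_Icc_eq hS]

lemma encard_Aset {T : ℕ → ℕ} {L : ℕ∞} (hT : ∀ i k : ℕ, i < k → (k : ℕ∞) < L → T i < T k) :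
    (Aset T L).encard = {i : ℕ | (i : ℕ∞) < L}.encard := by
  have : Aset T L = T '' {i : ℕ | (i : ℕ∞) < L} := rfl
  rw [this]
  refine Set.InjOn.encard_image fun i hi k hk h => ?_
  rcases lt_trichotomy i k with hlt | heq | hlt
  · exact absurd h (hT i k hlt hk).ne
  · exact heq
  · exact absurd h (hT k i hlt hi).ne'

/-! ## Finiteness to the left of the spine -/

lemma exists_infinite_child {t : Set Vertex} (hlf : LocFin t) (ht : IsTree t) {u : Vertex}
    (hu : (fringe t u).Infinite) : ∃ c, (fringe t (u ++ [c])).Infinite := by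
  by_contra! h
  refine hu (((Set.finite_singleton u).union
    ((hlf u).biUnion fun c _ => h c)).subset ?_)
  rintro x ⟨hx, y, rfl⟩
  cases y with
  | nil => simp
  | cons c y =>
    refine Or.inr (Set.mem_biUnion (x := c) ?_ ⟨hx, y, by simp⟩)
    exact ht.2.1 (u ++ [c]) y (by simpa using hx)

lemma mem_of_fringe_nonempty {t : Set Vertex} (ht : IsTree t) {u : Vertex}
    (hu : (fringe t u).Nonempty) : u ∈ t := by
  obtain ⟨x, hx, y, rfl⟩ := hu
  exact ht.2.1 u y hx

/-- A vertex with infinitely many descendants lies on a spine (König). -/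
lemma exists_isSpine_of_fringe_infinite {t : Set Vertex} (hlf : LocFin t) (ht : IsTree t)
    {u : Vertex} (hu : (fringe t u).Infinite) : ∃ η, IsSpine t η ∧ η u.length = u := by
  choose! c hc using fun (w : Vertex) (hw : (fringe t w).Infinite) =>
    exists_infinite_child hlf ht hw
  let g : ℕ → Vertex := fun k => (fun w => w ++ [c w])^[k] u
  have hgs : ∀ k, g (k + 1) = g k ++ [c (g k)] := fun k =>
    Function.iterate_succ_apply' _ k u
  have hg : ∀ k, (fringe t (g k)).Infinite := by
    intro k
    induction k with
    | zero => exact hu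
    | succ k ih => rw [hgs]; exact hc _ ih
  have hut := mem_of_fringe_nonempty ht hu.nonempty
  refine ⟨fun i => if i ≤ u.length then u.take i else g (i - u.length), ⟨by simp, ?_, ?_⟩,
    by simp⟩
  · intro i
    dsimp only
    split_ifs with hi
    · exact ht.2.1 _ (u.drop i) (by simpa using hut)
    · exact mem_of_fringe_nonempty ht (hg _).nonempty
  · intro i
    dsimp only
    rcases lt_trichotomy i u.length with hi | rfl | hi
    · rw [if_pos hi.le, if_pos (Nat.succ_le_of_lt hi)]
      exact ⟨u[i], by simp⟩
    · refine ⟨c u, ?_⟩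
      rw [if_neg (by omega), if_pos le_rfl, List.take_length, Nat.add_sub_cancel_left]
      exact hgs 0
    · refine ⟨c (g (i - u.length)), ?_⟩
      rw [if_neg (by omega), if_neg (by omega), Nat.sub_add_comm hi.le]
      exact hgs _

lemma IsSpine.length {t : Set Vertex} {η : ℕ → Vertex} (h : IsSpine t η) (i : ℕ) :
    (η i).length = i := by
  induction i with
  | zero => simp [h.1]
  | succ i ih =>
    obtain ⟨c, hc⟩ := h.2.2 i
    simp [hc, ih]

lemma IsSpine.strictMono {t : Set Vertex} {η : ℕ → Vertex} (h : IsSpine t η) :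
    StrictMono η := by
  refine strictMono_nat_of_lt_succ fun i => ?_
  obtain ⟨c, hc⟩ := h.2.2 i
  refine lt_of_le_of_ne (le_of_prefix (hc ▸ List.prefix_append _ _)) fun heq => ?_
  have := congrArg List.length heq
  rw [h.length, h.length] at this
  omega

lemma IsSpine.eq_of_prefix {t : Set Vertex} {η : ℕ → Vertex} (h : IsSpine t η) {v : Vertex}
    {j : ℕ} (hv : v <+: η j) : ∃ i, η i = v := by
  induction j with
  | zero =>
    rw [h.1, List.prefix_nil] at hv
    exact ⟨0, by rw [h.1, hv]⟩
  | succ j ih =>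
    obtain ⟨c, hc⟩ := h.2.2 j
    rw [hc, List.prefix_concat_iff] at hv
    rcases hv with hv | hv
    · exact ⟨j + 1, by rw [hc, hv]⟩
    · exact ih hv

lemma finite_preSet_spine {t : Set Vertex} (hlf : LocFin t) (ht : IsTree t) {η : ℕ → Vertex}
    (h : IsSpine t η) (huniq : ∀ η', IsSpine t η' → η' = η) (j : ℕ) :
    (preSet t (η j)).Finite := by
  induction j with
  | zero =>
    rw [h.1]
    refine Set.finite_empty.subset fun x hx => ?_
    exact absurd hx.2 (by simp)
  | succ j ih =>
    obtain ⟨c, hc⟩ := h.2.2 j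
    have hfr : ∀ d ∈ Set.Iio c, (fringe t (η j ++ [d])).Finite := by
      intro d hd
      by_contra hinf
      obtain ⟨η', hη', hu⟩ := exists_isSpine_of_fringe_infinite hlf ht hinf
      rw [huniq η' hη', List.length_append, h.length, List.length_singleton, hc] at hu
      simp at hu
      exact (Set.mem_Iio.1 hd).ne hu.symm
    refine ((ih.union (Set.finite_singleton (η j))).union
      ((Set.finite_Iio c).biUnion hfr)).subset ?_
    rintro x ⟨hx, hlt⟩
    rw [hc] at hlt
    rcases lt_append_singleton hlt with h1 | h1 | ⟨d, hd, h1⟩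
    · exact Or.inl (Or.inl ⟨hx, h1⟩)
    · exact Or.inl (Or.inr h1)
    · exact Or.inr (Set.mem_biUnion (x := d) hd ⟨hx, h1⟩)

lemma LeftOfSpine.finite_preSet_postSet {t : Set Vertex} {η : ℕ → Vertex} (h : IsSpine t η)
    (hfin : ∀ j, (preSet t (η j)).Finite) {v : Vertex} (hv : LeftOfSpine t η v) :
    (preSet t v).Finite ∧ (postSet t v).Finite := by
  obtain ⟨-, hne, j, hj⟩ := hv
  refine ⟨(hfin j).subset fun x hx => ⟨hx.1, hx.2.trans hj⟩, (hfin j).subset ?_⟩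
  rintro x ⟨hx, hp | ⟨hlt, -⟩⟩
  · refine ⟨hx, lt_of_lt_of_not_prefix_of_prefix hj (fun hpre => ?_) hp⟩
    obtain ⟨i, hi⟩ := h.eq_of_prefix hpre
    exact hne i hi
  · exact ⟨hx, hlt.trans hj⟩

/-! ## The sequences `s_i` and `s_i - p_i + 1` -/

lemma IsEnumOf.lt {A : Set Vertex} {l : ℕ → Vertex} (h : IsEnumOf A l) {i k : ℕ} (hik : i < k)
    (hk : (k : ℕ∞) < A.encard) : l i < l k := by
  have : l i ∈ {x ∈ A | x < l k} := by
    rw [(h k hk).2]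
    exact ⟨i, hik, rfl⟩
  exact this.2

lemma nil_notMem_postSet {t : Set Vertex} {v : Vertex} (hv : v ≠ []) : [] ∉ postSet t v := by
  rintro ⟨-, h | ⟨-, h⟩⟩
  · exact hv (List.prefix_nil.1 h)
  · exact h List.nil_prefix

/-- The conclusion for an enumerated set `D` of leaves, all having finite rank, given that
the complements of `{s_i}` and `{s_i - p_i + 1}` have matching sizes in `U`. -/
lemma increasing_bijection_of_enum {r D : Set Vertex} {l : ℕ → Vertex} {U : Set ℕ}
    (ht : IsTree r) (hD : ∀ v ∈ D, IsLeaf r v) (hnil : [] ∉ D)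
    (hfin : ∀ v ∈ D, (preSet r v).Finite ∧ (postSet r v).Finite) (hl : IsEnumOf D l)
    (hU1 : ∀ j ∈ U, 1 ≤ j) (hU : ∀ j ∈ U, ∀ k, 1 ≤ k → k ≤ j → k ∈ U)
    (hsize : (Aset (sVal r l) D.encard).encard = (Bset (sVal r l) (pVal l) D.encard).encard →
      Bset (sVal r l) (pVal l) D.encard ⊆ (fun v => (postSet r v).ncard) '' D →
      Aset (sVal r l) D.encard ⊆ (fun v => (preSet r v).ncard) '' D →
      (∀ j ∈ U, ∃ m ∈ U, rankIn (Bset (sVal r l) (pVal l) D.encard)ᶜ j ≤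
        rankIn (Aset (sVal r l) D.encard)ᶜ m) ∧
      ∀ m ∈ U, ∃ j ∈ U, rankIn (Aset (sVal r l) D.encard)ᶜ m ≤
        rankIn (Bset (sVal r l) (pVal l) D.encard)ᶜ j) :
    StrictMonoOn
      (fun j => betaL (sVal r l) D.encard (alphaL (sVal r l) (pVal l) D.encard j))
      (U \ Bset (sVal r l) (pVal l) D.encard) ∧
    Set.BijOn (fun j => betaL (sVal r l) D.encard (alphaL (sVal r l) (pVal l) D.encard j))
      (U \ Bset (sVal r l) (pVal l) D.encard) (U \ Aset (sVal r l) D.encard) ∧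
    ∀ j ∈ U \ Bset (sVal r l) (pVal l) D.encard,
      phi321Fun (sVal r l) (pVal l) D.encard j
        = (betaL (sVal r l) D.encard (alphaL (sVal r l) (pVal l) D.encard j) : ℕ∞) := by
  have hmem : ∀ i : ℕ, (i : ℕ∞) < D.encard → l i ∈ D := fun i hi => (hl i hi).1
  have hT : ∀ i : ℕ, (i : ℕ∞) < D.encard →
      sVal r l i - pVal l i + 1 = (postSet r (l i)).ncard := fun i hi =>
    (ncard_postSet_leaf ht (hD _ (hmem i hi)) (hfin _ (hmem i hi)).1).symm
  have hlt : ∀ i k : ℕ, i < k → (k : ℕ∞) < D.encard → (i : ℕ∞) < D.encard := fun i k hik hk =>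
    lt_trans (by exact_mod_cast hik) hk
  have hSmono : ∀ i k : ℕ, i < k → (k : ℕ∞) < D.encard → sVal r l i < sVal r l k :=
    fun i k hik hk => ncard_preSet_lt (hD _ (hmem i (hlt i k hik hk))).1 (hl.lt hik hk)
      (hfin _ (hmem k hk)).1
  have hTmono : ∀ i k : ℕ, i < k → (k : ℕ∞) < D.encard →
      sVal r l i - pVal l i + 1 < sVal r l k - pVal l k + 1 := by
    intro i k hik hk
    rw [hT i (hlt i k hik hk), hT k hk]
    have hkr := (hD _ (hmem k hk)).1
    refine ncard_postSet_lt hkr (hl.lt hik hk) (fun hp => ?_) (hfin _ (hmem k hk)).2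
    exact (hl.lt hik hk).ne' ((hD _ (hmem i (hlt i k hik hk))).eq_of_prefix ht hkr hp)
  have hS1 : ∀ i : ℕ, (i : ℕ∞) < D.encard → 1 ≤ sVal r l i := by
    intro i hi
    refine (Set.ncard_pos (hfin _ (hmem i hi)).1).2 ⟨[], ht.1, ?_⟩
    refine lt_of_le_of_ne (le_of_prefix List.nil_prefix) fun h => hnil ?_
    rw [h]
    exact hmem i hi
  have hα := alphaL_eq_rankIn (S := sVal r l) (P := pVal l) (L := D.encard)
    (succ_le_of_strictMono_of_pos (fun i _ => by omega) hTmono)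
  have hβ := betaL_eq_nthOf (S := sVal r l) (L := D.encard)
    (succ_le_of_strictMono_of_pos hS1 hSmono)
  have hcard : (Aset (sVal r l) D.encard).encard =
      (Bset (sVal r l) (pVal l) D.encard).encard :=
    (encard_Aset hSmono).trans (encard_Aset hTmono).symm
  obtain ⟨h1, h2⟩ := hsize hcard
    (by rintro b ⟨i, hi, rfl⟩; exact ⟨l i, hmem i hi, (hT i hi).symm⟩)
    (by rintro b ⟨i, hi, rfl⟩; exact ⟨l i, hmem i hi, rfl⟩)
  obtain ⟨h3, h4⟩ := strictMonoOn_bijOn_nthOf hU1 hU h1 h2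
  simp only [hα, hβ]
  refine ⟨h3, h4, fun j hj => ?_⟩
  rw [phi321Fun, dif_neg hj.2]

/-- For `r ∈ 𝔗_f` or `r ∈ 𝔗_∞`, the unique increasing bijection from
`{s_i - p_i + 1 : i}ᶜ` to `{s_i : i}ᶜ` (complements in `[n]`, resp. `ℕ`) is
`j ↦ β_{r,j} := betaL S L (alphaL S P L j)`; in particular on the complement it computes
`Φ^{321}_r`. -/
theorem beta_is_the_increasing_bijection (r : Set Vertex) (l : ℕ → Vertex)
    (Lc : ℕ∞) (U : Set ℕ)
    (hcase :
      (MemTf r ∧ IsEnumOf (leafSet r) l ∧ Lc = (leafSet r).encard ∧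
        U = Set.Icc 1 (r.ncard - 1)) ∨
      (∃ η : ℕ → Vertex, IsTree r ∧ LocFin r ∧ r.Infinite ∧ SpineSpec r η ∧
        IsEnumOf (leftLeaves r η) l ∧ Lc = (leftLeaves r η).encard ∧
        U = {m : ℕ | 1 ≤ m})) :
    StrictMonoOn (fun j => betaL (sVal r l) Lc (alphaL (sVal r l) (pVal l) Lc j))
      (U \ Bset (sVal r l) (pVal l) Lc) ∧
    Set.BijOn (fun j => betaL (sVal r l) Lc (alphaL (sVal r l) (pVal l) Lc j))
      (U \ Bset (sVal r l) (pVal l) Lc) (U \ Aset (sVal r l) Lc) ∧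
    ∀ j ∈ U \ Bset (sVal r l) (pVal l) Lc,
      phi321Fun (sVal r l) (pVal l) Lc j
        = (betaL (sVal r l) Lc (alphaL (sVal r l) (pVal l) Lc j) : ℕ∞) := by
  rcases hcase with ⟨⟨ht, hrfin, h2⟩, hl, rfl, rfl⟩ | ⟨η, ht, hlf, -, hspec, hl, rfl, rfl⟩
  · have hcard : 2 ≤ r.ncard := by
      rw [← hrfin.cast_ncard_eq] at h2
      exact_mod_cast h2
    have hnil : [] ∉ leafSet r := by
      intro h
      have hsub : r ⊆ {[]} := fun x hx => IsLeaf.eq_of_prefix ht h hx List.nil_prefix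
      have := Set.ncard_le_ncard hsub
      rw [Set.ncard_singleton] at this
      omega
    refine increasing_bijection_of_enum ht (fun v hv => hv) hnil
      (fun v _ => ⟨hrfin.subset fun x hx => hx.1, hrfin.subset fun x hx => hx.1⟩) hl
      (fun j hj => hj.1) (fun j hj k h1 h2 => ⟨h1, h2.trans hj.2⟩) ?_
    intro hAB hB hA
    have hBsub : Bset (sVal r l) (pVal l) (leafSet r).encard ⊆ Set.Icc 1 (r.ncard - 1) := by
      intro b hb
      obtain ⟨v, hv, rfl⟩ := hB hb
      have hvnil : v ≠ [] := by rintro rfl; exact hnil hv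
      refine ⟨(Set.ncard_pos (hrfin.subset fun x hx => hx.1)).2
        ⟨v, hv.1, Or.inl (List.prefix_refl v)⟩, ?_⟩
      rw [← Set.ncard_sdiff_singleton_of_mem ht.1]
      refine Set.ncard_le_ncard (fun x hx => ⟨hx.1, ?_⟩) hrfin.sdiff
      rintro rfl
      exact nil_notMem_postSet hvnil hx
    have hAsub : Aset (sVal r l) (leafSet r).encard ⊆ Set.Icc 1 (r.ncard - 1) := by
      intro b hb
      obtain ⟨v, hv, rfl⟩ := hA hb
      have hvnil : v ≠ [] := by rintro rfl; exact hnil hv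
      refine ⟨(Set.ncard_pos (hrfin.subset fun x hx => hx.1)).2
        ⟨[], ht.1, lt_of_le_of_ne (le_of_prefix List.nil_prefix) hvnil.symm⟩, ?_⟩
      rw [← Set.ncard_sdiff_singleton_of_mem hv.1]
      exact Set.ncard_le_ncard (fun x hx => ⟨hx.1, hx.2.ne⟩) hrfin.sdiff
    have hrank : rankIn (Aset (sVal r l) (leafSet r).encard)ᶜ (r.ncard - 1) =
        rankIn (Bset (sVal r l) (pVal l) (leafSet r).encard)ᶜ (r.ncard - 1) := by
      rw [rankIn_compl hAsub, rankIn_compl hBsub]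
      exact congrArg (fun e : ℕ∞ => r.ncard - 1 - e.toNat) hAB
    have hn : r.ncard - 1 ∈ Set.Icc 1 (r.ncard - 1) := ⟨by omega, le_rfl⟩
    exact ⟨fun j hj => ⟨_, hn, (rankIn_mono _ hj.2).trans hrank.ge⟩,
      fun j hj => ⟨_, hn, (rankIn_mono _ hj.2).trans hrank.le⟩⟩
  · obtain ⟨hη, huniq, -, -, hbig⟩ := hspec
    have hpre := finite_preSet_spine hlf ht hη huniq
    have hfin : ∀ {v}, LeftOfSpine r η v → (preSet r v).Finite ∧ (postSet r v).Finite :=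
      fun hv => hv.finite_preSet_postSet hη hpre
    refine increasing_bijection_of_enum ht (fun v hv => hv.1) (fun h => h.2.2.1 0 hη.1)
      (fun v hv => hfin hv.2) hl (fun j hj => hj) (fun j _ k h1 _ => h1) ?_
    intro _ hB hA
    have hAinf : (Aset (sVal r l) (leftLeaves r η).encard)ᶜ.Infinite := by
      have hinj : Function.Injective fun k => (preSet r (η k)).ncard := fun i k h =>
        hη.strictMono.injective (ncard_preSet_injOn r ⟨hη.2.1 i, hpre i⟩ ⟨hη.2.1 k, hpre k⟩ h)
      refine (Set.infinite_range_of_injective hinj).mono ?_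
      rintro _ ⟨k, rfl⟩ hk
      obtain ⟨v, hv, hvk⟩ := hA hk
      exact hv.2.2.1 k
        (ncard_preSet_injOn r ⟨hv.2.1, (hfin hv.2).1⟩ ⟨hη.2.1 k, hpre k⟩ hvk).symm
    have hBinf : (Bset (sVal r l) (pVal l) (leftLeaves r η).encard)ᶜ.Infinite := by
      refine (hbig.image (f := fun v => (postSet r v).ncard) fun v hv w hw h => ?_).mono ?_
      · exact ncard_postSet_injOn r ⟨hv.2.1.1, (hfin hv.2.1).2⟩ ⟨hw.2.1.1, (hfin hw.2.1).2⟩ h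
      · rintro _ ⟨u, ⟨-, hu, hu2⟩, rfl⟩ hk
        obtain ⟨v, hv, hvu⟩ := hB hk
        obtain rfl := ncard_postSet_injOn r ⟨hv.2.1, (hfin hv.2).2⟩ ⟨hu.1, (hfin hu).2⟩ hvu
        have hsub : fringe r v ⊆ {v} := fun x hx => hv.1.eq_of_prefix ht hx.1 hx.2
        have := hu2.trans (Set.encard_le_encard hsub)
        rw [Set.encard_singleton] at this
        exact absurd this (by norm_num)
    exact ⟨fun j _ => exists_le_rankIn hAinf _, fun j _ => exists_le_rankIn hBinf _⟩

end AvoidPaper
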